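/- arXiv:1508.05133 — 5 statements merged into one kernel-verified Lean document; each statement's English description precedes it below -/
import Mathlib

section
/- Let γ_d be the standard Gaussian measure on ℝ^d (density (2π)^{-d/2} exp(-‖w‖²/2)) and let x_i, x_j ∈ ℝ^d be nonzero. Set ρ = ⟨x_i,x_j⟩/(‖x_i‖‖x_j‖) and θ = arccos ρ. Then ∫_{ℝ^d} max(0, ⟨x_i, w⟩) · max(0, ⟨x_j, w⟩) dγ_d(w) = (‖x_i‖‖x_j‖ / (2π)) · ( sin θ + (π − θ)·ρ ). -/
open MeasureTheory ProbabilityTheory Real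

lemma integral_cexp_sum_mul_I_pi_gaussianReal {ι : Type*} [Fintype ι] (c : ι → ℝ) :
    ∫ w, Complex.exp ((∑ k, c k * w k : ℝ) * Complex.I)
        ∂(Measure.pi (fun _ : ι => gaussianReal 0 1)) =
      Complex.exp (-((∑ k, c k ^ 2 : ℝ) : ℂ) / 2) := by
  have h (w : ι → ℝ) : Complex.exp ((∑ k, c k * w k : ℝ) * Complex.I) =
      ∏ k, Complex.exp (c k * w k * Complex.I) := by
    rw [← Complex.exp_sum]
    push_cast
    rw [Finset.sum_mul]
  simp_rw [h]
  rw [integral_fintype_prod_eq_prod (f := fun k (x : ℝ) => Complex.exp (c k * x * Complex.I))]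
  simp_rw [← charFun_apply_real, charFun_gaussianReal, ← Complex.exp_sum]
  congr 1
  push_cast
  rw [← Finset.sum_neg_distrib, Finset.sum_div]
  exact Finset.sum_congr rfl fun k _ => by simp [neg_div]

lemma integral_cexp_add_mul_I_prod_gaussianReal (p q : ℝ) :
    ∫ z : ℝ × ℝ, Complex.exp ((p * z.1 + q * z.2 : ℝ) * Complex.I)
        ∂((gaussianReal 0 1).prod (gaussianReal 0 1)) =
      Complex.exp (-((p ^ 2 + q ^ 2 : ℝ) : ℂ) / 2) := by
  have h (z : ℝ × ℝ) : Complex.exp ((p * z.1 + q * z.2 : ℝ) * Complex.I) =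
      Complex.exp (p * z.1 * Complex.I) * Complex.exp (q * z.2 * Complex.I) := by
    rw [← Complex.exp_add]
    push_cast
    ring_nf
  simp_rw [h]
  rw [integral_prod_mul (fun x : ℝ => Complex.exp (p * x * Complex.I))
    (fun x : ℝ => Complex.exp (q * x * Complex.I)), ← charFun_apply_real, ← charFun_apply_real,
    charFun_gaussianReal, charFun_gaussianReal, ← Complex.exp_add]
  congr 1
  push_cast
  simp
  ring

/-- Two linear functionals of a standard Gaussian vector have the same joint law as their
realization on a standard Gaussian pair with the same covariances. -/
lemma map_pi_gaussianReal_eq_map_prod {ι : Type*} [Fintype ι] (x y : ι → ℝ) {a b c : ℝ}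
    (hx : ∑ k, x k ^ 2 = a ^ 2) (hxy : ∑ k, x k * y k = a * b)
    (hy : ∑ k, y k ^ 2 = b ^ 2 + c ^ 2) :
    (Measure.pi (fun _ : ι => gaussianReal 0 1)).map
        (fun w => (∑ k, x k * w k, ∑ k, y k * w k)) =
      ((gaussianReal 0 1).prod (gaussianReal 0 1)).map
        (fun z : ℝ × ℝ => (a * z.1, b * z.1 + c * z.2)) := by
  have m1 : Measurable (fun w : ι → ℝ => (∑ k, x k * w k, ∑ k, y k * w k)) := by fun_prop
  have m2 : Measurable (fun z : ℝ × ℝ => (a * z.1, b * z.1 + c * z.2)) := by fun_prop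
  have := Measure.isProbabilityMeasure_map
    (μ := Measure.pi (fun _ : ι => gaussianReal 0 1)) m1.aemeasurable
  have := Measure.isProbabilityMeasure_map
    (μ := (gaussianReal 0 1).prod (gaussianReal 0 1)) m2.aemeasurable
  refine Measure.ext_of_charFunDual (funext fun L => ?_)
  have hL (u v : ℝ) : L (u, v) = L (1, 0) * u + L (0, 1) * v := by
    have : ((u, v) : ℝ × ℝ) = u • (1, 0) + v • (0, 1) := by simp
    rw [this, map_add, map_smul, map_smul, smul_eq_mul, smul_eq_mul, mul_comm, mul_comm v]
  set p := L (1, 0)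
  set q := L (0, 1)
  rw [charFunDual_apply, charFunDual_apply, integral_map m1.aemeasurable (by fun_prop),
    integral_map m2.aemeasurable (by fun_prop)]
  have h1 (w : ι → ℝ) : L (∑ k, x k * w k, ∑ k, y k * w k) =
      ∑ k, (p * x k + q * y k) * w k := by
    rw [hL, Finset.mul_sum, Finset.mul_sum, ← Finset.sum_add_distrib]
    exact Finset.sum_congr rfl fun k _ => by ring
  have h2 (z : ℝ × ℝ) : L (a * z.1, b * z.1 + c * z.2) =
      (p * a + q * b) * z.1 + (q * c) * z.2 := by
    rw [hL]; ring
  simp_rw [h1, h2]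
  rw [integral_cexp_sum_mul_I_pi_gaussianReal, integral_cexp_add_mul_I_prod_gaussianReal]
  have : ∑ k, (p * x k + q * y k) ^ 2 = (p * a + q * b) ^ 2 + (q * c) ^ 2 := by
    calc ∑ k, (p * x k + q * y k) ^ 2
        = p ^ 2 * ∑ k, x k ^ 2 + 2 * p * q * ∑ k, x k * y k + q ^ 2 * ∑ k, y k ^ 2 := by
          simp_rw [Finset.mul_sum, ← Finset.sum_add_distrib]
          exact Finset.sum_congr rfl fun k _ => by ring
      _ = _ := by rw [hx, hxy, hy]; ring
  rw [this]

lemma integral_max_cos_mul_max_cos_sub {θ : ℝ} (h0 : 0 ≤ θ) (hπ : θ ≤ π) :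
    ∫ φ in Set.Ioo (-π) π, max 0 (cos φ) * max 0 (cos (φ - θ)) =
      (sin θ + (π - θ) * cos θ) / 2 := by
  have hpi := pi_pos
  have hsub : Set.Ioc (θ - π / 2) (π / 2) ⊆ Set.Ioo (-π) π := fun φ hφ =>
    ⟨by linarith [hφ.1], by linarith [hφ.2]⟩
  rw [setIntegral_eq_of_subset_of_forall_sdiff_eq_zero measurableSet_Ioo hsub]
  · rw [setIntegral_congr_fun (g := fun φ => cos φ * cos (φ - θ)) measurableSet_Ioc,
      ← intervalIntegral.integral_of_le (by linarith),
      intervalIntegral.integral_eq_sub_of_hasDerivAt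
        (f := fun φ => (φ * cos θ + sin (2 * φ - θ) / 2) / 2)]
    · rw [show 2 * (π / 2) - θ = π - θ by ring, show 2 * (θ - π / 2) - θ = -(π - θ) by ring,
        sin_neg, sin_pi_sub]
      ring
    · intro φ _
      have hd : HasDerivAt (fun φ : ℝ => 2 * φ - θ) 2 φ := by
        simpa using ((hasDerivAt_id φ).const_mul 2).sub_const θ
      refine ((((hasDerivAt_id φ).mul_const (cos θ)).add (hd.sin.div_const 2)).div_const
        2).congr_deriv ?_
      have e1 : cos (2 * φ - θ) = cos φ * cos (φ - θ) - sin φ * sin (φ - θ) := by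
        rw [← cos_add]; ring_nf
      have e2 : cos θ = cos φ * cos (φ - θ) + sin φ * sin (φ - θ) := by
        rw [← cos_sub]; ring_nf
      rw [e1, e2]
      ring
    · exact Continuous.intervalIntegrable (by fun_prop) _ _
    · intro φ hφ
      have h1 : 0 ≤ cos φ := cos_nonneg_of_mem_Icc ⟨by linarith [hφ.1], by linarith [hφ.2]⟩
      have h2 : 0 ≤ cos (φ - θ) :=
        cos_nonneg_of_mem_Icc ⟨by linarith [hφ.1], by linarith [hφ.2]⟩
      simp only [max_eq_right h1, max_eq_right h2]
  · rintro φ ⟨⟨hφ1, hφ2⟩, hφ⟩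
    by_cases h : cos φ ≤ 0
    · rw [max_eq_left h, zero_mul]
    · have hlo : -(π / 2) < φ := by
        by_contra! hc
        refine h ?_
        rw [← cos_neg]
        exact cos_nonpos_of_pi_div_two_le_of_le (by linarith) (by linarith)
      have hhi : φ ≤ π / 2 := by
        by_contra! hc
        exact h (cos_nonpos_of_pi_div_two_le_of_le hc.le (by linarith))
      have hle : φ ≤ θ - π / 2 := by
        by_contra! hc
        exact hφ ⟨hc, hhi⟩
      rw [max_eq_left (a := (0 : ℝ)) (b := cos (φ - θ)), mul_zero]
      rw [← cos_neg]
      exact cos_nonpos_of_pi_div_two_le_of_le (by linarith) (by linarith)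

lemma integral_pow_three_mul_exp_neg_sq_div_two :
    ∫ r in Set.Ioi (0 : ℝ), r ^ 3 * exp (-(r ^ 2) / 2) = 2 := by
  have h := integral_rpow_mul_exp_neg_mul_rpow (p := 2) (q := 3) (b := 1 / 2)
    (by norm_num) (by norm_num) (by norm_num)
  rw [show ((3 : ℝ) + 1) / 2 = 1 + 1 by norm_num, Gamma_add_one one_ne_zero, Gamma_one,
    show -((3 : ℝ) + 1) / 2 = ((-2 : ℤ) : ℝ) by norm_num, rpow_intCast] at h
  norm_num at h
  refine (setIntegral_congr_fun measurableSet_Ioi fun r _ => ?_).trans h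
  ring_nf

lemma integral_prod_gaussianReal (f : ℝ × ℝ → ℝ) :
    ∫ z, f z ∂((gaussianReal 0 1).prod (gaussianReal 0 1)) =
      ∫ z, (2 * π)⁻¹ * exp (-(z.1 ^ 2 + z.2 ^ 2) / 2) * f z := by
  rw [gaussianReal_of_var_ne_zero 0 one_ne_zero,
    prod_withDensity (measurable_gaussianPDF 0 1) (measurable_gaussianPDF 0 1),
    integral_withDensity_eq_integral_toReal_smul (by fun_prop)
      (.of_forall fun z => ENNReal.mul_lt_top gaussianPDF_lt_top gaussianPDF_lt_top)]
  refine integral_congr_ae (.of_forall fun z => ?_)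
  simp only [ENNReal.toReal_mul, toReal_gaussianPDF, smul_eq_mul, gaussianPDFReal]
  simp only [NNReal.coe_one, mul_one, sub_zero]
  have hs : (√(2 * π))⁻¹ * (√(2 * π))⁻¹ = (2 * π)⁻¹ := by
    rw [← mul_inv, mul_self_sqrt (by positivity)]
  rw [show -(z.1 ^ 2 + z.2 ^ 2) / 2 = -z.1 ^ 2 / 2 + -z.2 ^ 2 / 2 by ring, exp_add, ← hs]
  ring

lemma integral_relu_mul_relu_prod_gaussianReal {θ : ℝ} (h0 : 0 ≤ θ) (hπ : θ ≤ π) :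
    ∫ z : ℝ × ℝ, max 0 z.1 * max 0 (cos θ * z.1 + sin θ * z.2)
        ∂((gaussianReal 0 1).prod (gaussianReal 0 1)) =
      (2 * π)⁻¹ * (sin θ + (π - θ) * cos θ) := by
  rw [integral_prod_gaussianReal, ← integral_comp_polarCoord_symm, polarCoord_target,
    setIntegral_congr_fun (g := fun p : ℝ × ℝ => ((2 * π)⁻¹ * (p.1 ^ 3 * exp (-(p.1 ^ 2) / 2))) *
      (max 0 (cos p.2) * max 0 (cos (p.2 - θ)))) (measurableSet_Ioi.prod measurableSet_Ioo),
    Measure.volume_eq_prod,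
    setIntegral_prod_mul (fun r : ℝ => (2 * π)⁻¹ * (r ^ 3 * exp (-(r ^ 2) / 2)))
      (fun φ => max 0 (cos φ) * max 0 (cos (φ - θ))),
    integral_const_mul, integral_pow_three_mul_exp_neg_sq_div_two,
    integral_max_cos_mul_max_cos_sub h0 hπ]
  · ring
  · rintro ⟨r, φ⟩ ⟨hr, -⟩
    have hr : 0 ≤ r := le_of_lt hr
    have hm (t : ℝ) : max 0 (r * t) = r * max 0 t := by
      rw [mul_max_of_nonneg _ _ hr, mul_zero]
    simp only [polarCoord_symm_apply, smul_eq_mul]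
    rw [show cos θ * (r * cos φ) + sin θ * (r * sin φ) = r * cos (φ - θ) by rw [cos_sub]; ring,
      hm, hm, show (r * cos φ) ^ 2 + (r * sin φ) ^ 2 = r ^ 2 by
        rw [mul_pow, mul_pow, ← mul_add, cos_sq_add_sin_sq, mul_one]]
    ring

/-- With `γd` the standard Gaussian measure on `ℝ^d` and nonzero
`xi, xj ∈ ℝ^d`, setting `ρ = ⟨xi,xj⟩/(‖xi‖‖xj‖)` and `θ = arccos ρ`,
`∫ relu(⟨xi,w⟩) relu(⟨xj,w⟩) dγd(w) = (‖xi‖‖xj‖/(2π)) (sin θ + (π − θ) ρ)`. -/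
theorem stmt2 (d : ℕ) (xi xj : Fin d → ℝ) (hxi : xi ≠ 0) (hxj : xj ≠ 0)
    (γd : Measure (Fin d → ℝ))
    (hγd : γd = Measure.pi (fun _ : Fin d => gaussianReal 0 1))
    (ρ θ : ℝ)
    (hρ : ρ = (∑ k, xi k * xj k) /
      (Real.sqrt (∑ k, xi k ^ 2) * Real.sqrt (∑ k, xj k ^ 2)))
    (hθ : θ = Real.arccos ρ) :
    (∫ w, max 0 (∑ k, xi k * w k) * max 0 (∑ k, xj k * w k) ∂γd)
      = (Real.sqrt (∑ k, xi k ^ 2) * Real.sqrt (∑ k, xj k ^ 2) / (2 * π)) *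
        (Real.sin θ + (π - θ) * ρ) := by
  have hpos {x : Fin d → ℝ} (hx : x ≠ 0) : 0 < √(∑ k, x k ^ 2) := by
    obtain ⟨k, hk⟩ := Function.ne_iff.mp hx
    exact sqrt_pos.2 (Finset.sum_pos' (fun k _ => sq_nonneg _)
      ⟨k, Finset.mem_univ k, sq_pos_of_ne_zero hk⟩)
  have hsq (x : Fin d → ℝ) : ∑ k, x k ^ 2 = √(∑ k, x k ^ 2) ^ 2 :=
    (sq_sqrt (Finset.sum_nonneg fun k _ => sq_nonneg _)).symm
  have ha := hpos hxi
  have hb := hpos hxj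
  have hasq := hsq xi
  have hbsq := hsq xj
  set a := √(∑ k, xi k ^ 2)
  set b := √(∑ k, xj k ^ 2)
  have habs : |∑ k, xi k * xj k| ≤ a * b := by
    refine abs_le_of_sq_le_sq ?_ (by positivity)
    rw [mul_pow, ← hasq, ← hbsq]
    exact Finset.sum_mul_sq_le_sq_mul_sq _ _ _
  have hcos : cos θ = ρ := by
    have hle : |ρ| ≤ 1 := by
      rw [hρ, abs_div, abs_of_pos (mul_pos ha hb)]
      exact div_le_one_of_le₀ habs (by positivity)
    rw [hθ, cos_arccos (abs_le.1 hle).1 (abs_le.1 hle).2]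
  have hxy : ∑ k, xi k * xj k = a * (b * cos θ) := by
    rw [hcos, hρ]
    field_simp
  have hy : ∑ k, xj k ^ 2 = (b * cos θ) ^ 2 + (b * sin θ) ^ 2 := by
    rw [mul_pow, mul_pow, ← mul_add, cos_sq_add_sin_sq, mul_one, hbsq]
  have hmap := map_pi_gaussianReal_eq_map_prod xi xj hasq hxy hy
  have key := congrArg (fun μ : Measure (ℝ × ℝ) => ∫ z, max 0 z.1 * max 0 z.2 ∂μ) hmap
  rw [integral_map (by fun_prop) (by fun_prop), integral_map (by fun_prop) (by fun_prop)] at key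
  have hrelu (z : ℝ × ℝ) : max 0 (a * z.1) * max 0 (b * cos θ * z.1 + b * sin θ * z.2) =
      a * b * (max 0 z.1 * max 0 (cos θ * z.1 + sin θ * z.2)) := by
    rw [show b * cos θ * z.1 + b * sin θ * z.2 = b * (cos θ * z.1 + sin θ * z.2) by ring,
      ← mul_zero a, ← mul_max_of_nonneg _ _ ha.le, mul_zero, ← mul_zero b,
      ← mul_max_of_nonneg _ _ hb.le, mul_zero]
    ring
  rw [hγd, key]
  simp_rw [hrelu]
  rw [integral_const_mul, integral_relu_mul_relu_prod_gaussianReal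
    (hθ ▸ arccos_nonneg ρ) (hθ ▸ arccos_le_pi ρ), hcos]
  ring
end

section
/- Let γ_d be the standard Gaussian measure on ℝ^d and let x_i, x_j ∈ ℝ^d be nonzero. Set ρ = ⟨x_i,x_j⟩/(‖x_i‖‖x_j‖). Then γ_d({w ∈ ℝ^d : ⟨x_i, w⟩ ≥ 0 and ⟨x_j, w⟩ ≥ 0}) = (π − arccos ρ) / (2π). -/
open MeasureTheory ProbabilityTheory Real

lemma measurableSet_nonneg_and_nonneg {α : Type*} [MeasurableSpace α] {f g : α → ℝ}
    (hf : Measurable f) (hg : Measurable g) : MeasurableSet {x | 0 ≤ f x ∧ 0 ≤ g x} := by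
  rw [Set.ofPred_and]
  exact (measurableSet_le measurable_const hf).inter (measurableSet_le measurable_const hg)

/-- The standard Gaussian measure of a planar cone is proportional to its opening angle. -/
lemma gaussianReal_prod_cone {S : Set (ℝ × ℝ)} (hS : MeasurableSet S) {T : Set ℝ}
    (hT : MeasurableSet T)
    (hST : ∀ r φ : ℝ, 0 < r → ((r * cos φ, r * sin φ) ∈ S ↔ φ ∈ T)) :
    ((gaussianReal 0 1).prod (gaussianReal 0 1)) S
      = volume (Set.Ioo (-π) π ∩ T) / ENNReal.ofReal (2 * π) := by
  set g : ℝ → ENNReal := fun r => ENNReal.ofReal r *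
    ENNReal.ofReal ((√(2 * π))⁻¹ * (√(2 * π))⁻¹ * rexp (-r ^ 2 / 2)) with hg
  have hgm : Measurable g := by fun_prop
  have key : ∀ (S : Set (ℝ × ℝ)) (T : Set ℝ), MeasurableSet S → MeasurableSet T →
      (∀ r φ : ℝ, 0 < r → ((r * cos φ, r * sin φ) ∈ S ↔ φ ∈ T)) →
      ((gaussianReal 0 1).prod (gaussianReal 0 1)) S
        = (∫⁻ r in Set.Ioi 0, g r) * volume (Set.Ioo (-π) π ∩ T) := by
    intro S T hS hT hST
    rw [gaussianReal_of_var_ne_zero 0 one_ne_zero,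
      prod_withDensity (measurable_gaussianPDF 0 1) (measurable_gaussianPDF 0 1),
      withDensity_apply _ hS, ← lintegral_indicator hS, ← Measure.volume_eq_prod,
      ← lintegral_comp_polarCoord_symm, polarCoord_target]
    have h1 : ∀ p ∈ Set.Ioi (0 : ℝ) ×ˢ Set.Ioo (-π) π,
        ENNReal.ofReal p.1 • S.indicator (fun z => gaussianPDF 0 1 z.1 * gaussianPDF 0 1 z.2)
          (polarCoord.symm p) = g p.1 * T.indicator 1 p.2 := by
      rintro ⟨r, φ⟩ ⟨hr, -⟩
      have hr : 0 < r := hr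
      rw [polarCoord_symm_apply]
      by_cases h : φ ∈ T
      · rw [Set.indicator_of_mem ((hST r φ hr).2 h), Set.indicator_of_mem h]
        simp only [gaussianPDF, gaussianPDFReal, smul_eq_mul, Pi.one_apply, mul_one, hg]
        rw [← ENNReal.ofReal_mul (by positivity)]
        congr 2
        rw [mul_mul_mul_comm, ← Real.exp_add]
        simp only [NNReal.coe_one, mul_one, sub_zero]
        congr 2
        linear_combination (-r ^ 2 / 2) * sin_sq_add_cos_sq φ
      · rw [Set.indicator_of_notMem (fun h' => h ((hST r φ hr).1 h')),
          Set.indicator_of_notMem h]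
        simp
    rw [setLIntegral_congr_fun (measurableSet_Ioi.prod measurableSet_Ioo) h1,
      Measure.volume_eq_prod, ← Measure.prod_restrict,
      lintegral_prod_mul hgm.aemeasurable (measurable_one.indicator hT).aemeasurable,
      lintegral_indicator_one hT, Measure.restrict_apply hT, Set.inter_comm]
  have huniv := key Set.univ Set.univ .univ .univ (by simp)
  rw [measure_univ, Set.inter_univ, Real.volume_Ioo, sub_neg_eq_add, ← two_mul] at huniv
  rw [key S T hS hT hST, ENNReal.eq_inv_of_mul_eq_one_left huniv.symm, mul_comm,
    ENNReal.div_eq_inv_mul, mul_comm]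

lemma volume_cos_nonneg_inter {θ : ℝ} (h0 : 0 ≤ θ) (hπ : θ ≤ π) :
    volume (Set.Ioo (-π) π ∩ {φ | 0 ≤ cos φ ∧ 0 ≤ cos (φ - θ)}) = ENNReal.ofReal (π - θ) := by
  have hpi := Real.pi_pos
  apply le_antisymm
  · calc _ ≤ volume (Set.Icc (θ - π / 2) (π / 2) ∪ {-(π / 2)}) := by
          apply measure_mono
          rintro φ ⟨⟨h1, h2⟩, h3, h4⟩
          have h5 : φ ≤ π / 2 := by
            by_contra! h
            exact absurd (cos_neg_of_pi_div_two_lt_of_lt h (by linarith)) (by linarith)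
          have h6 : -(π / 2) ≤ φ := by
            by_contra! h
            have := cos_neg_of_pi_div_two_lt_of_lt (x := -φ) (by linarith) (by linarith)
            rw [cos_neg] at this
            linarith
          by_cases h7 : φ = -(π / 2)
          · exact Or.inr h7
          · refine Or.inl ⟨?_, h5⟩
            by_contra! h
            have h8 : -(π / 2) < φ := lt_of_le_of_ne h6 (Ne.symm h7)
            have := cos_neg_of_pi_div_two_lt_of_lt (x := -(φ - θ)) (by linarith) (by linarith)
            rw [cos_neg] at this
            linarith
      _ ≤ volume (Set.Icc (θ - π / 2) (π / 2)) + volume {-(π / 2)} := measure_union_le _ _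
      _ = ENNReal.ofReal (π - θ) := by
          rw [Real.volume_Icc, Real.volume_singleton, add_zero]; congr 1; ring
  · calc ENNReal.ofReal (π - θ) = volume (Set.Icc (θ - π / 2) (π / 2)) := by
          rw [Real.volume_Icc]; congr 1; ring
      _ ≤ _ := by
          apply measure_mono
          rintro φ ⟨h1, h2⟩
          exact ⟨⟨by linarith, by linarith⟩, cos_nonneg_of_mem_Icc ⟨by linarith, h2⟩,
            cos_nonneg_of_mem_Icc ⟨by linarith, by linarith⟩⟩

/-- Orthant probability of a pair of standard Gaussians with correlation `cos θ`. -/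
lemma gaussianReal_prod_wedge {θ : ℝ} (h0 : 0 ≤ θ) (hπ : θ ≤ π) :
    ((gaussianReal 0 1).prod (gaussianReal 0 1))
        {p | 0 ≤ p.1 ∧ 0 ≤ cos θ * p.1 + sin θ * p.2}
      = ENNReal.ofReal ((π - θ) / (2 * π)) := by
  rw [gaussianReal_prod_cone (T := {φ | 0 ≤ cos φ ∧ 0 ≤ cos (φ - θ)}),
    volume_cos_nonneg_inter h0 hπ, ENNReal.ofReal_div_of_pos (by positivity)]
  · exact measurableSet_nonneg_and_nonneg (by fun_prop) (by fun_prop)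
  · exact measurableSet_nonneg_and_nonneg (by fun_prop) (by fun_prop)
  · intro r φ hr
    have : cos θ * (r * cos φ) + sin θ * (r * sin φ) = r * cos (φ - θ) := by
      rw [cos_sub]; ring
    simp only [Set.mem_ofPred_eq, this, mul_nonneg_iff_of_pos_left hr]

lemma integral_exp_sum_mul_pi_gaussianReal {ι : Type*} [Fintype ι] (a : ι → ℝ) :
    ∫ w, Complex.exp ((∑ k, a k * w k : ℝ) * Complex.I)
        ∂(Measure.pi fun _ : ι => gaussianReal 0 1)
      = Complex.exp (-((∑ k, a k ^ 2 : ℝ) : ℂ) / 2) := by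
  simp_rw [Complex.ofReal_sum, Finset.sum_mul, Complex.exp_sum, Complex.ofReal_mul]
  rw [integral_fintype_prod_eq_prod (f := fun k (x : ℝ) => Complex.exp (a k * (x : ℂ) * Complex.I))]
  simp_rw [← charFun_apply_real, charFun_gaussianReal, ← Complex.exp_sum]
  simp [Finset.sum_div, neg_div]

lemma integral_exp_mul_add_mul_prod_gaussianReal (a b : ℝ) :
    ∫ p, Complex.exp ((a * p.1 + b * p.2 : ℝ) * Complex.I)
        ∂((gaussianReal 0 1).prod (gaussianReal 0 1))
      = Complex.exp (-((a ^ 2 + b ^ 2 : ℝ) : ℂ) / 2) := by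
  simp_rw [Complex.ofReal_add, add_mul, Complex.exp_add, Complex.ofReal_mul]
  rw [integral_prod_mul (fun x : ℝ => Complex.exp (a * (x : ℂ) * Complex.I))
    (fun x : ℝ => Complex.exp (b * (x : ℂ) * Complex.I))]
  simp_rw [← charFun_apply_real, charFun_gaussianReal, ← Complex.exp_add]
  congr 1
  push_cast
  ring

/-- Two linear forms with unit coefficient vectors at angle `θ` are jointly distributed under the
standard Gaussian measure as a pair of standard Gaussians with correlation `cos θ`. -/
lemma map_pi_gaussianReal_pair {ι : Type*} [Fintype ι] {u v : ι → ℝ} {θ : ℝ}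
    (hu : ∑ k, u k ^ 2 = 1) (hv : ∑ k, v k ^ 2 = 1) (huv : ∑ k, u k * v k = cos θ) :
    (Measure.pi fun _ : ι => gaussianReal 0 1).map
        (fun w => (∑ k, u k * w k, ∑ k, v k * w k))
      = ((gaussianReal 0 1).prod (gaussianReal 0 1)).map
        (fun p => (p.1, cos θ * p.1 + sin θ * p.2)) := by
  have hm : Measurable fun w : ι → ℝ => (∑ k, u k * w k, ∑ k, v k * w k) := by fun_prop
  have hm' : Measurable fun p : ℝ × ℝ => (p.1, cos θ * p.1 + sin θ * p.2) := by fun_prop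
  have := Measure.isProbabilityMeasure_map (μ := Measure.pi fun _ : ι => gaussianReal 0 1)
    hm.aemeasurable
  have := Measure.isProbabilityMeasure_map
    (μ := (gaussianReal 0 1).prod (gaussianReal 0 1)) hm'.aemeasurable
  apply Measure.ext_of_charFunDual
  ext L
  have hL : ∀ x y : ℝ, L (x, y) = L (1, 0) * x + L (0, 1) * y := by
    intro x y
    have : ((x, y) : ℝ × ℝ) = x • (1, 0) + y • (0, 1) := by simp
    rw [this, map_add, map_smul, map_smul, smul_eq_mul, smul_eq_mul]
    ring
  generalize L (1, 0) = s at hL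
  generalize L (0, 1) = t at hL
  have hc : Measurable fun p : ℝ × ℝ => Complex.exp (L p * Complex.I) := by fun_prop
  rw [charFunDual_apply, charFunDual_apply,
    integral_map hm.aemeasurable hc.aestronglyMeasurable,
    integral_map hm'.aemeasurable hc.aestronglyMeasurable]
  simp_rw [hL]
  have e1 : ∀ w : ι → ℝ, s * ∑ k, u k * w k + t * ∑ k, v k * w k
      = ∑ k, (s * u k + t * v k) * w k := by
    intro w
    rw [Finset.mul_sum, Finset.mul_sum, ← Finset.sum_add_distrib]
    exact Finset.sum_congr rfl fun k _ => by ring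
  have e2 : ∀ p : ℝ × ℝ, s * p.1 + t * (cos θ * p.1 + sin θ * p.2)
      = (s + t * cos θ) * p.1 + (t * sin θ) * p.2 := by
    intro p; ring
  simp_rw [e1, e2]
  rw [integral_exp_sum_mul_pi_gaussianReal, integral_exp_mul_add_mul_prod_gaussianReal]
  have e3 : ∑ k, (s * u k + t * v k) ^ 2
      = s ^ 2 * ∑ k, u k ^ 2 + 2 * s * t * ∑ k, u k * v k + t ^ 2 * ∑ k, v k ^ 2 := by
    simp_rw [Finset.mul_sum, ← Finset.sum_add_distrib]
    exact Finset.sum_congr rfl fun k _ => by ring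
  rw [e3, hu, hv, huv]
  congr 4
  linear_combination (-t ^ 2) * sin_sq_add_cos_sq θ

lemma sum_sq_pos_of_ne_zero {ι : Type*} [Fintype ι] {x : ι → ℝ} (hx : x ≠ 0) :
    0 < ∑ k, x k ^ 2 := by
  obtain ⟨k, hk⟩ := Function.ne_iff.1 hx
  exact Finset.sum_pos' (fun _ _ => sq_nonneg _) ⟨k, Finset.mem_univ k, sq_pos_of_ne_zero hk⟩

lemma sum_div_sqrt_sum_sq {ι : Type*} [Fintype ι] {x : ι → ℝ} (hx : x ≠ 0) :
    ∑ k, (x k / √(∑ k, x k ^ 2)) ^ 2 = 1 := by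
  have h := sum_sq_pos_of_ne_zero hx
  simp_rw [div_pow, Real.sq_sqrt h.le, ← Finset.sum_div]
  exact div_self h.ne'

/-- With `γd` the standard Gaussian measure on `ℝ^d` and nonzero
`xi, xj ∈ ℝ^d`, setting `ρ = ⟨xi,xj⟩/(‖xi‖‖xj‖)`, the Gaussian measure of the
intersection of the two half-spaces `{⟨xi,w⟩ ≥ 0}` and `{⟨xj,w⟩ ≥ 0}` equals
`(π − arccos ρ)/(2π)`. -/
theorem stmt3 (d : ℕ) (xi xj : Fin d → ℝ) (hxi : xi ≠ 0) (hxj : xj ≠ 0)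
    (γd : Measure (Fin d → ℝ))
    (hγd : γd = Measure.pi (fun _ : Fin d => gaussianReal 0 1))
    (ρ : ℝ)
    (hρ : ρ = (∑ k, xi k * xj k) /
      (Real.sqrt (∑ k, xi k ^ 2) * Real.sqrt (∑ k, xj k ^ 2))) :
    γd {w | 0 ≤ ∑ k, xi k * w k ∧ 0 ≤ ∑ k, xj k * w k}
      = ENNReal.ofReal ((π - Real.arccos ρ) / (2 * π)) := by
  have hi := Real.sqrt_pos.2 (sum_sq_pos_of_ne_zero hxi)
  have hj := Real.sqrt_pos.2 (sum_sq_pos_of_ne_zero hxj)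
  have hu := sum_div_sqrt_sum_sq hxi
  have hv := sum_div_sqrt_sum_sq hxj
  set a := √(∑ k, xi k ^ 2)
  set b := √(∑ k, xj k ^ 2)
  have huv : ∑ k, xi k / a * (xj k / b) = ρ := by
    simp_rw [hρ, div_mul_div_comm, ← Finset.sum_div]
  have hρ1 : ρ ^ 2 ≤ 1 := by
    have := Finset.sum_mul_sq_le_sq_mul_sq Finset.univ (fun k => xi k / a) (fun k => xj k / b)
    rwa [hu, hv, huv, one_mul] at this
  obtain ⟨hl, hr⟩ := abs_le.1 ((sq_le_one_iff_abs_le_one ρ).1 hρ1)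
  have hset : {w : Fin d → ℝ | 0 ≤ ∑ k, xi k * w k ∧ 0 ≤ ∑ k, xj k * w k}
      = (fun w => (∑ k, xi k / a * w k, ∑ k, xj k / b * w k)) ⁻¹'
        {q : ℝ × ℝ | 0 ≤ q.1 ∧ 0 ≤ q.2} := by
    ext w
    simp only [Set.mem_ofPred_eq, Set.mem_preimage, div_mul_eq_mul_div, ← Finset.sum_div,
      le_div_iff₀ hi, le_div_iff₀ hj, zero_mul]
  have hQ : MeasurableSet {q : ℝ × ℝ | 0 ≤ q.1 ∧ 0 ≤ q.2} :=
    measurableSet_nonneg_and_nonneg measurable_fst measurable_snd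
  rw [hγd, hset, ← Measure.map_apply (by fun_prop) hQ,
    map_pi_gaussianReal_pair hu hv (huv.trans (Real.cos_arccos hl hr).symm),
    Measure.map_apply (by fun_prop) hQ]
  exact gaussianReal_prod_wedge (Real.arccos_nonneg ρ) (Real.arccos_le_pi ρ)
end

section
/- Let σ > 0, let w be a Gaussian random vector in ℝ^d with law N(0, σ²I), let b be uniformly distributed on [0, 2π] and independent of w, and let g(t) = √2·cos(t). Then for all w₁, w₂ ∈ ℝ^d: E[ g(⟨w₁, w⟩ + b) · g(⟨w₂, w⟩ + b) ] = exp( −σ²‖w₁ − w₂‖² / 2 ). -/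
open MeasureTheory ProbabilityTheory Real

/-- The second harmonic of a uniformly distributed phase averages out. -/
theorem integral_two_mul_cos_mul_cos_uniform_phase (x y : ℝ) :
    ∫ b, √2 * cos (x + b) * (√2 * cos (y + b))
        ∂((ENNReal.ofReal (2 * π))⁻¹ • volume.restrict (Set.Icc 0 (2 * π))) = cos (x - y) := by
  have hπ := pi_pos
  have product_to_sum (b : ℝ) : √2 * cos (x + b) * (√2 * cos (y + b)) =
      cos (x - y) + cos (2 * b + (x + y)) := by
    have h := two_mul_cos_mul_cos (x + b) (y + b)
    rw [show x + b - (y + b) = x - y by ring, show x + b + (y + b) = 2 * b + (x + y) by ring] at h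
    rw [← h]
    linear_combination (cos (x + b) * cos (y + b)) * mul_self_sqrt (zero_le_two (α := ℝ))
  have harmonic : ∫ b in (0 : ℝ)..2 * π, cos (2 * b + (x + y)) = 0 := by
    rw [intervalIntegral.integral_comp_mul_add (f := cos) two_ne_zero, integral_cos,
      show 2 * (2 * π) + (x + y) = x + y + (2 : ℕ) * (2 * π) by push_cast; ring,
      sin_add_nat_mul_two_pi]
    simp
  simp_rw [product_to_sum]
  rw [integral_smul_measure, integral_Icc_eq_integral_Ioc,
    ← intervalIntegral.integral_of_le (by positivity),
    intervalIntegral.integral_add (by simp) (Continuous.intervalIntegrable (by fun_prop) _ _),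
    harmonic, intervalIntegral.integral_const, ENNReal.toReal_inv,
    ENNReal.toReal_ofReal (by positivity)]
  simp only [smul_eq_mul, sub_zero, add_zero]
  field_simp

/-- The real part of the characteristic function of a centered isotropic Gaussian vector. -/
theorem integral_cos_sum_mul_pi_gaussianReal {ι : Type*} [Fintype ι] (v : NNReal) (u : ι → ℝ) :
    ∫ z, cos (∑ k, u k * z k) ∂(Measure.pi fun _ : ι => gaussianReal 0 v) =
      exp (-v * (∑ k, u k ^ 2) / 2) := by
  have hchar : ∫ z, Complex.exp ((∑ k, u k * z k : ℝ) * Complex.I)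
      ∂(Measure.pi fun _ : ι => gaussianReal 0 v) = (exp (-v * (∑ k, u k ^ 2) / 2) : ℝ) := by
    have hprod (z : ι → ℝ) : Complex.exp ((∑ k, u k * z k : ℝ) * Complex.I) =
        ∏ k, Complex.exp (u k * z k * Complex.I) := by
      rw [← Complex.exp_sum, ← Finset.sum_mul]
      push_cast
      rfl
    simp_rw [hprod]
    rw [integral_fintype_prod_eq_prod (fun k (t : ℝ) => Complex.exp (u k * t * Complex.I))]
    simp_rw [← charFun_apply_real, charFun_gaussianReal, ← Complex.exp_sum]
    push_cast
    congr 1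
    rw [Finset.mul_sum, Finset.sum_div]
    exact Finset.sum_congr rfl fun k _ => by ring
  have hint : Integrable (fun z => Complex.exp ((∑ k, u k * z k : ℝ) * Complex.I))
      (Measure.pi fun _ : ι => gaussianReal 0 v) :=
    Integrable.of_bound (Continuous.aestronglyMeasurable (by fun_prop)) 1
      (.of_forall fun z => (Complex.norm_exp_ofReal_mul_I _).le)
  have hre := integral_re hint
  simp only [RCLike.re_eq_complex_re, Complex.exp_ofReal_mul_I_re] at hre
  rw [hre, hchar, Complex.ofReal_re]


open MeasureTheory ProbabilityTheory Real

/-- Let `σ > 0`, let `w ∼ N(0, σ²I)` on `ℝ^d`, let `b` be uniform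
on `[0, 2π]` independent of `w`, and `g(t) = √2 cos t`. Then for all
`w₁, w₂ ∈ ℝ^d`,
`E[g(⟨w₁,w⟩ + b) g(⟨w₂,w⟩ + b)] = exp(−σ²‖w₁ − w₂‖²/2)`. -/
theorem stmt12 (d : ℕ) (σ : ℝ) (hσ : 0 < σ)
    (unif : Measure ℝ)
    (hunif : unif = (ENNReal.ofReal (2 * π))⁻¹ • volume.restrict (Set.Icc 0 (2 * π)))
    (μ : Measure ((Fin d → ℝ) × ℝ))
    (hμ : μ = (Measure.pi (fun _ : Fin d => gaussianReal 0 (Real.toNNReal (σ ^ 2)))).prod unif)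
    (g : ℝ → ℝ) (hg : g = fun t => Real.sqrt 2 * Real.cos t)
    (w₁ w₂ : Fin d → ℝ) :
    (∫ p, g ((∑ k, w₁ k * p.1 k) + p.2) * g ((∑ k, w₂ k * p.1 k) + p.2) ∂μ)
      = Real.exp (-(σ ^ 2) * (∑ k, (w₁ k - w₂ k) ^ 2) / 2) := by
  subst hunif hμ hg
  have : IsFiniteMeasure
      ((ENNReal.ofReal (2 * π))⁻¹ • volume.restrict (Set.Icc 0 (2 * π)) : Measure ℝ) :=
    Measure.smul_finite _ (by simp [pi_pos])
  have hint : Integrable (fun p : (Fin d → ℝ) × ℝ =>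
      √2 * cos ((∑ k, w₁ k * p.1 k) + p.2) * (√2 * cos ((∑ k, w₂ k * p.1 k) + p.2)))
      ((Measure.pi fun _ : Fin d => gaussianReal 0 (toNNReal (σ ^ 2))).prod
        ((ENNReal.ofReal (2 * π))⁻¹ • volume.restrict (Set.Icc 0 (2 * π)))) := by
    refine Integrable.of_bound (Continuous.aestronglyMeasurable (by fun_prop)) (√2 * √2)
      (.of_forall fun p => ?_)
    have hbound (t : ℝ) : ‖√2 * cos t‖ ≤ √2 := by
      rw [norm_mul, norm_of_nonneg (sqrt_nonneg 2)]
      exact mul_le_of_le_one_right (sqrt_nonneg 2) (abs_cos_le_one t)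
    rw [norm_mul]
    exact mul_le_mul (hbound _) (hbound _) (norm_nonneg _) (sqrt_nonneg 2)
  rw [integral_prod _ hint]
  simp_rw [integral_two_mul_cos_mul_cos_uniform_phase, ← Finset.sum_sub_distrib, ← sub_mul]
  rw [integral_cos_sum_mul_pi_gaussianReal _ (fun k => w₁ k - w₂ k),
    coe_toNNReal _ (sq_nonneg σ)]
end

section
/- Let H be a real Hilbert space, λ > 0, L ≥ 0, m ≥ 1. Let ℓ₁, …, ℓ_m : H → ℝ and ℓ'_i : H → ℝ be convex and L-Lipschitz functions, where ℓ'_j = ℓ_j for all j ≠ i (only the i-th term is replaced). Define F(v) = (1/m)Σ_{j=1}^m ℓ_j(v) + (λ/2)‖v‖² and F'(v) = (1/m)Σ_{j=1}^m ℓ'_j(v) + (λ/2)‖v‖². If v minimizes F over H and v' minimizes F' over H, then ‖v − v'‖ ≤ 2L/(λm). -/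
open MeasureTheory

/-- A strongly convex function grows at least quadratically around a minimizer. -/
theorem StrongConvexOn.add_sq_le_of_isMinOn {E : Type*} [NormedAddCommGroup E] [NormedSpace ℝ E]
    {s : Set E} {μ : ℝ} {f : E → ℝ} (hf : StrongConvexOn s μ f) {x y : E} (hx : x ∈ s)
    (hy : y ∈ s) (hmin : IsMinOn f s x) : f x + μ / 2 * ‖x - y‖ ^ 2 ≤ f y := by
  have hlim : Filter.Tendsto (fun t : ℝ => f x + (1 - t) * (μ / 2 * ‖x - y‖ ^ 2))
      (nhdsWithin 0 (Set.Ioi 0)) (nhds (f x + μ / 2 * ‖x - y‖ ^ 2)) := by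
    refine tendsto_nhdsWithin_of_tendsto_nhds (Continuous.tendsto' (by fun_prop) _ _ ?_)
    simp
  refine le_of_tendsto hlim ?_
  filter_upwards [Ioo_mem_nhdsGT (zero_lt_one (α := ℝ))] with t ht
  have h1t : 0 ≤ 1 - t := sub_nonneg.2 ht.2.le
  have hle := isMinOn_iff.1 hmin _ (hf.1 hx hy h1t ht.1.le (sub_add_cancel 1 t))
  have hconv := hf.2 hx hy h1t ht.1.le (sub_add_cancel 1 t)
  simp only [smul_eq_mul] at hconv
  refine le_of_mul_le_mul_left ?_ ht.1
  linarith

/-- A nonnegative multiple of a sum of convex functions, plus `lam / 2 * ‖v‖ ^ 2`, is `lam`-strongly convex. -/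
theorem strongConvexOn_mul_sum_add_sq {ι H : Type*} [Fintype ι] [NormedAddCommGroup H]
    [InnerProductSpace ℝ H] {s : Set H} (hs : Convex ℝ s) {c : ℝ} (hc : 0 ≤ c) (lam : ℝ)
    {f : ι → H → ℝ} (hf : ∀ j, ConvexOn ℝ s (f j)) :
    StrongConvexOn s lam fun v => c * (∑ j, f j v) + lam / 2 * ‖v‖ ^ 2 := by
  rw [strongConvexOn_iff_convex]
  have hsum : ConvexOn ℝ s fun v => ∑ j, f j v := by
    refine ⟨hs, fun x hx y hy a b ha hb hab => ?_⟩
    simp only [Finset.smul_sum, ← Finset.sum_add_distrib]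
    exact Finset.sum_le_sum fun j _ => (hf j).2 hx hy ha hb hab
  simpa using hsum.smul hc

/-- Replace-one uniform stability of regularized empirical risk
minimization: if `ℓ₁, …, ℓ_m` and `ℓ'₁, …, ℓ'_m` are convex `L`-Lipschitz
functions on a real Hilbert space `H` agreeing except in the `i`-th term, and
`v`, `v'` minimize `F(v) = (1/m)Σⱼ ℓⱼ(v) + (λ/2)‖v‖²` and the corresponding
`F'`, then `‖v − v'‖ ≤ 2L/(λm)`. -/
theorem stmt13 {H : Type*} [NormedAddCommGroup H] [InnerProductSpace ℝ H]
    (lam : ℝ) (hlam : 0 < lam) (L : ℝ) (hL : 0 ≤ L)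
    (m : ℕ) (hm : 1 ≤ m) (i : Fin m)
    (ℓ ℓ' : Fin m → H → ℝ)
    (hconv : ∀ j, ConvexOn ℝ Set.univ (ℓ j))
    (hconv' : ∀ j, ConvexOn ℝ Set.univ (ℓ' j))
    (hlip : ∀ j, ∀ a b : H, |ℓ j a - ℓ j b| ≤ L * ‖a - b‖)
    (hlip' : ∀ j, ∀ a b : H, |ℓ' j a - ℓ' j b| ≤ L * ‖a - b‖)
    (hagree : ∀ j, j ≠ i → ℓ' j = ℓ j)
    (F F' : H → ℝ)
    (hF : F = fun v => (1 / m) * (∑ j, ℓ j v) + lam / 2 * ‖v‖ ^ 2)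
    (hF' : F' = fun v => (1 / m) * (∑ j, ℓ' j v) + lam / 2 * ‖v‖ ^ 2)
    (v v' : H)
    (hv : ∀ w, F v ≤ F w) (hv' : ∀ w, F' v' ≤ F' w) :
    ‖v - v'‖ ≤ 2 * L / (lam * m) := by
  have hm0 : (0 : ℝ) < m := by exact_mod_cast hm
  have hc : (0 : ℝ) ≤ 1 / m := by positivity
  have hgrow : F v + lam / 2 * ‖v - v'‖ ^ 2 ≤ F v' := by
    subst hF
    exact (strongConvexOn_mul_sum_add_sq convex_univ hc lam hconv).add_sq_le_of_isMinOn
      (Set.mem_univ v) (Set.mem_univ v') (isMinOn_iff.2 fun w _ => hv w)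
  have hgrow' : F' v' + lam / 2 * ‖v - v'‖ ^ 2 ≤ F' v := by
    subst hF'
    rw [norm_sub_rev]
    exact (strongConvexOn_mul_sum_add_sq convex_univ hc lam hconv').add_sq_le_of_isMinOn
      (Set.mem_univ v') (Set.mem_univ v) (isMinOn_iff.2 fun w _ => hv' w)
  have hdiff (w : H) : F w - F' w = 1 / m * (ℓ i w - ℓ' i w) := by
    have hsum : ∑ j, (ℓ j w - ℓ' j w) = ℓ i w - ℓ' i w :=
      Finset.sum_eq_single i (fun j _ hj => by rw [hagree j hj, sub_self]) (by simp)
    rw [← hsum, Finset.sum_sub_distrib, hF, hF']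
    ring
  have hloss : ℓ i v' - ℓ' i v' - (ℓ i v - ℓ' i v) ≤ 2 * L * ‖v - v'‖ := by
    have h := (abs_le.1 (hlip i v v')).1
    have h' := (abs_le.1 (hlip' i v v')).2
    linarith
  have hsq : lam * ‖v - v'‖ ^ 2 ≤ 1 / m * (2 * L * ‖v - v'‖) := by
    have h := mul_le_mul_of_nonneg_left hloss hc
    linarith [hdiff v, hdiff v']
  rw [le_div_iff₀ (by positivity)]
  rcases (norm_nonneg (v - v')).eq_or_lt with h0 | hpos
  · rw [← h0]
    linarith
  · refine le_of_mul_le_mul_right ?_ hpos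
    rw [one_div, inv_mul_eq_div, le_div_iff₀ hm0] at hsq
    linarith
end

section
/- Let H be a separable real Hilbert space, (Z, 𝒵) a measurable space, D a probability measure on Z, λ > 0, m ≥ 1. Let ℓ : H × Z → ℝ be such that ℓ(·, z) is convex and 1-Lipschitz for every z ∈ Z, ℓ(v, ·) is measurable for every v ∈ H, and ℓ is bounded below (with suitable integrability so all integrals below are finite). For a sample S = (z₁, …, z_m) ∈ Z^m define L_S(v) = (1/m)Σ_{i=1}^m ℓ(v, z_i), L_D(v) = ∫ ℓ(v, z) dD(z), and let v^S be the unique minimizer over H of L_S(v) + (λ/2)‖v‖² (which exists by strong convexity). Then, for S drawn i.i.d. from D^m: E_{S∼D^m}[ L_D(v^S) − L_S(v^S) ] ≤ 2/(λ·m). -/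
open MeasureTheory

/-- Replacing one coordinate of an i.i.d. sample by a fresh draw gives again an i.i.d. sample. -/
lemma measurePreserving_update_prod {ι Z : Type*} [Fintype ι] [DecidableEq ι] [MeasurableSpace Z]
    (D : Measure Z) [IsProbabilityMeasure D] (i : ι) :
    MeasurePreserving (fun p : (ι → Z) × Z => Function.update p.1 i p.2)
      ((Measure.pi fun _ : ι => D).prod D) (Measure.pi fun _ : ι => D) := by
  have hm : Measurable (fun p : (ι → Z) × Z => Function.update p.1 i p.2) := by
    refine measurable_pi_lambda _ fun j => ?_
    by_cases h : j = i
    · subst h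
      simpa using measurable_snd
    · simp only [Function.update_of_ne h]
      exact (measurable_pi_apply j).comp measurable_fst
  refine ⟨hm, (Measure.pi_eq fun s hs => ?_).symm⟩
  rw [Measure.map_apply hm (MeasurableSet.univ_pi hs)]
  have hpre : (fun p : (ι → Z) × Z => Function.update p.1 i p.2) ⁻¹' (Set.univ.pi s)
      = (Set.univ.pi (Function.update s i Set.univ)) ×ˢ s i := by
    ext ⟨S, z⟩
    simp only [Set.mem_preimage, Set.mem_pi, Set.mem_univ, true_implies, Set.mem_prod]
    constructor
    · refine fun h => ⟨fun j => ?_, by simpa using h i⟩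
      by_cases hj : j = i
      · subst hj
        simp
      · simpa [Function.update_of_ne hj] using h j
    · rintro ⟨h, hz⟩ j
      by_cases hj : j = i
      · subst hj
        simpa using hz
      · simpa [Function.update_of_ne hj] using h j
  rw [hpre, Measure.prod_prod, Measure.pi_pi, ← Finset.mul_prod_erase _ _ (Finset.mem_univ i),
    ← Finset.mul_prod_erase _ (fun j => D (s j)) (Finset.mem_univ i)]
  have herase : ∏ j ∈ Finset.univ.erase i, D (Function.update s i Set.univ j)
      = ∏ j ∈ Finset.univ.erase i, D (s j) :=
    Finset.prod_congr rfl fun j hj => by rw [Function.update_of_ne (Finset.ne_of_mem_erase hj)]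
  rw [herase, Function.update_self, measure_univ, one_mul, mul_comm]

/-- Minimizers of a regularized `1`-Lipschitz function are bounded. -/
lemma LipschitzWith.norm_le_of_isMin_add_sq {H : Type*} [NormedAddCommGroup H] {f : H → ℝ}
    (hf : LipschitzWith 1 f) {c : ℝ} (hc : 0 < c) {v : H}
    (hv : ∀ w, f v + c * ‖v‖ ^ 2 ≤ f w + c * ‖w‖ ^ 2) :
    ‖v‖ ≤ 1 / c := by
  have h0 := hv 0
  have hl := (le_abs_self _).trans (hf.dist_le_mul 0 v)
  simp only [norm_zero, NNReal.coe_one, one_mul, dist_zero_left] at h0 hl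
  rcases (norm_nonneg v).eq_or_lt with h | h
  · rw [← h]
    positivity
  · rw [le_div_iff₀ hc]
    refine le_of_mul_le_mul_left ?_ h
    linarith

section RegularizedMinimizer

variable {H : Type*} [NormedAddCommGroup H] [InnerProductSpace ℝ H]

/-- Quadratic growth of a regularized convex function at its minimizer. -/
lemma ConvexOn.quadratic_growth_of_isMin_add_sq {f : H → ℝ} (hf : ConvexOn ℝ Set.univ f)
    {c : ℝ} {v : H} (hv : ∀ w, f v + c * ‖v‖ ^ 2 ≤ f w + c * ‖w‖ ^ 2) (w : H) :
    f v + c * ‖v‖ ^ 2 + c * ‖w - v‖ ^ 2 ≤ f w + c * ‖w‖ ^ 2 := by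
  have key : ∀ t ∈ Set.Ioo (0 : ℝ) 1,
      (1 - t) * (c * ‖w - v‖ ^ 2) ≤ f w + c * ‖w‖ ^ 2 - (f v + c * ‖v‖ ^ 2) := by
    rintro t ⟨ht0, ht1⟩
    have hcv := hf.2 (Set.mem_univ v) (Set.mem_univ w) (sub_nonneg.2 ht1.le) ht0.le
      (sub_add_cancel 1 t)
    simp only [smul_eq_mul] at hcv
    have hmin := hv ((1 - t) • v + t • w)
    have hnorm : ‖(1 - t) • v + t • w‖ ^ 2
        = (1 - t) * ‖v‖ ^ 2 + t * ‖w‖ ^ 2 - t * (1 - t) * ‖w - v‖ ^ 2 := by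
      rw [norm_add_sq_real, norm_sub_sq_real, norm_smul, norm_smul, inner_smul_left,
        inner_smul_right, mul_pow, mul_pow, Real.norm_eq_abs, Real.norm_eq_abs, sq_abs, sq_abs,
        real_inner_comm v w]
      simp only [conj_trivial]
      ring
    rw [hnorm] at hmin
    refine le_of_mul_le_mul_left ?_ ht0
    linarith
  have hlim : Filter.Tendsto (fun t : ℝ => (1 - t) * (c * ‖w - v‖ ^ 2))
      (nhdsWithin 0 (Set.Ioi 0)) (nhds (c * ‖w - v‖ ^ 2)) := by
    have hc : Continuous fun t : ℝ => (1 - t) * (c * ‖w - v‖ ^ 2) := by fun_prop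
    simpa using (hc.tendsto 0).mono_left nhdsWithin_le_nhds
  have := le_of_tendsto hlim
    (Filter.eventually_of_mem (Ioo_mem_nhdsGT (zero_lt_one' ℝ)) key)
  linarith

/-- If the difference of two convex functions varies by at most `2 * K * ‖v - w‖` between their
regularized minimizers `v` and `w`, then `‖v - w‖ ≤ K / c`, where `c` is the regularization
weight. -/
lemma norm_sub_le_of_isMin_add_sq {f g : H → ℝ} (hf : ConvexOn ℝ Set.univ f)
    (hg : ConvexOn ℝ Set.univ g) {c K : ℝ} (hc : 0 < c) (hK : 0 ≤ K) {v w : H}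
    (hv : ∀ u, f v + c * ‖v‖ ^ 2 ≤ f u + c * ‖u‖ ^ 2)
    (hw : ∀ u, g w + c * ‖w‖ ^ 2 ≤ g u + c * ‖u‖ ^ 2)
    (hfg : (f w - g w) - (f v - g v) ≤ 2 * K * ‖v - w‖) :
    ‖v - w‖ ≤ K / c := by
  have h1 := hf.quadratic_growth_of_isMin_add_sq hv w
  have h2 := hg.quadratic_growth_of_isMin_add_sq hw v
  rw [norm_sub_rev] at h1
  rcases (norm_nonneg (v - w)).eq_or_lt with h | h
  · rw [← h]
    positivity
  · rw [le_div_iff₀ hc]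
    refine le_of_mul_le_mul_left ?_ h
    linarith

/-- A parametrized family of regularized minimizers of convex continuous functions depends
measurably on the parameter. -/
lemma measurable_of_isMin_add_sq [SecondCountableTopology H] [MeasurableSpace H] [BorelSpace H]
    {Ω : Type*} [MeasurableSpace Ω] {f : Ω → H → ℝ} (hconv : ∀ ω, ConvexOn ℝ Set.univ (f ω))
    (hcont : ∀ ω, Continuous (f ω)) (hmeas : ∀ v, Measurable fun ω => f ω v)
    {c : ℝ} (hc : 0 < c) {V : Ω → H}
    (hV : ∀ ω w, f ω (V ω) + c * ‖V ω‖ ^ 2 ≤ f ω w + c * ‖w‖ ^ 2) :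
    Measurable V := by
  classical
  set F : Ω → H → ℝ := fun ω w => f ω w + c * ‖w‖ ^ 2 with hF
  have hFc : ∀ ω, Continuous (F ω) := fun ω => by
    have := hcont ω
    fun_prop
  have hFm : ∀ w, Measurable fun ω => F ω w := fun w => (hmeas w).add_const _
  set d := TopologicalSpace.denseSeq H
  have hex : ∀ ω, ∀ ε > 0, ∃ k, F ω (d k) < F ω (V ω) + ε := fun ω ε hε => by
    obtain ⟨_, hx, k, rfl⟩ := (TopologicalSpace.denseRange_denseSeq H).inter_open_nonempty
      {w | F ω w < F ω (V ω) + ε} (isOpen_lt (hFc ω) continuous_const)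
      ⟨V ω, by simpa using hε⟩
    exact ⟨k, hx⟩
  have hmin : Measurable fun ω => F ω (V ω) := by
    have heq : (fun ω => F ω (V ω)) = fun ω => ⨅ k, F ω (d k) := by
      funext ω
      refine le_antisymm (le_ciInf fun k => hV ω _) (le_of_forall_pos_lt_add fun ε hε => ?_)
      obtain ⟨k, hk⟩ := hex ω ε hε
      exact (ciInf_le ⟨F ω (V ω), by rintro _ ⟨k, rfl⟩; exact hV ω _⟩ k).trans_lt hk
    rw [heq]
    exact Measurable.iInf fun k => hFm (d k)
  have hpos : ∀ n : ℕ, (0 : ℝ) < 1 / (n + 1) := fun n => by positivity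
  refine measurable_of_tendsto_metrizable
    (f := fun (n : ℕ) ω => d (Nat.find (hex ω _ (hpos n)))) (fun n => ?_) ?_
  · exact Measurable.find (f := fun k _ => d k) (fun k => measurable_const)
      (fun k => measurableSet_lt (hFm (d k)) (hmin.add_const _)) fun ω => hex ω _ (hpos n)
  · refine tendsto_pi_nhds.2 fun ω => ?_
    rw [tendsto_iff_norm_sub_tendsto_zero]
    have hsq : Filter.Tendsto
        (fun n : ℕ => ‖d (Nat.find (hex ω _ (hpos n))) - V ω‖ ^ 2) Filter.atTop (nhds 0) := by
      have hlim : Filter.Tendsto (fun n : ℕ => (1 / ((n : ℝ) + 1)) / c) Filter.atTop (nhds 0) := by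
        simpa using tendsto_one_div_add_atTop_nhds_zero_nat.div_const c
      refine squeeze_zero (fun n => by positivity) (fun n => ?_) hlim
      have h1 := Nat.find_spec (hex ω _ (hpos n))
      have h2 := (hconv ω).quadratic_growth_of_isMin_add_sq (hV ω)
        (d (Nat.find (hex ω _ (hpos n))))
      rw [le_div_iff₀ hc]
      simp only [hF] at h1
      linarith
    simpa [Real.sqrt_sq (norm_nonneg _)] using hsq.sqrt

end RegularizedMinimizer

/-- Generalization by stability for regularized loss minimization
(the paper's Theorem 2). Let `ℓ : H × Z → ℝ` be convex and `1`-Lipschitz in its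
first argument, measurable in its second, and bounded below (with suitable
integrability hypotheses so that all the integrals are finite). For a sample
`S ∈ Z^m` let `v^S` be the minimizer over `H` of `L_S(v) + (λ/2)‖v‖²`, where
`L_S(v) = (1/m)Σᵢ ℓ(v, Sᵢ)` and `L_D(v) = ∫ ℓ(v, z) dD(z)`. Then for `S`
drawn i.i.d. from `D^m`, `E_S[L_D(v^S) − L_S(v^S)] ≤ 2/(λm)`. -/
theorem stmt14 {H : Type*} [NormedAddCommGroup H] [InnerProductSpace ℝ H]
    [SecondCountableTopology H] [CompleteSpace H] [MeasurableSpace H] [BorelSpace H]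
    {Z : Type*} [MeasurableSpace Z]
    (D : Measure Z) [IsProbabilityMeasure D]
    (lam : ℝ) (hlam : 0 < lam) (m : ℕ) (hm : 1 ≤ m)
    (ℓ : H → Z → ℝ)
    (hconv : ∀ z, ConvexOn ℝ Set.univ (fun v => ℓ v z))
    (hlip : ∀ z, LipschitzWith 1 (fun v => ℓ v z))
    (hmeas : ∀ v, Measurable (ℓ v))
    (hbdd : ∃ C : ℝ, ∀ (v : H) (z : Z), C ≤ ℓ v z)
    (hint : ∀ v : H, Integrable (ℓ v) D)
    (LS : (Fin m → Z) → H → ℝ)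
    (hLS : LS = fun S v => (1 / m) * ∑ i, ℓ v (S i))
    (LD : H → ℝ) (hLD : LD = fun v => ∫ z, ℓ v z ∂D)
    (vS : (Fin m → Z) → H)
    (hvS : ∀ S : Fin m → Z, ∀ w : H,
      LS S (vS S) + lam / 2 * ‖vS S‖ ^ 2 ≤ LS S w + lam / 2 * ‖w‖ ^ 2)
    (hgapint : Integrable (fun S => LD (vS S) - LS S (vS S))
      (Measure.pi (fun _ : Fin m => D))) :
    (∫ S, (LD (vS S) - LS S (vS S)) ∂(Measure.pi (fun _ : Fin m => D)))
      ≤ 2 / (lam * m) := by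
  have hm0 : (0 : ℝ) < m := by exact_mod_cast hm
  have hc : 0 < lam / 2 := by positivity
  set P := Measure.pi fun _ : Fin m => D with hP
  have hLSconv : ∀ S, ConvexOn ℝ Set.univ (LS S) := fun S => by
    have hsum : ConvexOn ℝ Set.univ fun v => ∑ i, ℓ v (S i) := by
      refine ⟨convex_univ, fun x _ y _ a b ha hb hab => ?_⟩
      simp only [smul_eq_mul, Finset.mul_sum, ← Finset.sum_add_distrib]
      exact Finset.sum_le_sum fun i _ =>
        (hconv (S i)).2 (Set.mem_univ x) (Set.mem_univ y) ha hb hab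
    have := hsum.smul (c := 1 / (m : ℝ)) (by positivity)
    simpa only [hLS, smul_eq_mul] using this
  have hℓ : ∀ v w z, ℓ v z - ℓ w z ≤ ‖v - w‖ := fun v w z => by
    simpa [dist_eq_norm] using (le_abs_self _).trans ((hlip z).dist_le_mul v w)
  have hLSlip : ∀ S, LipschitzWith 1 (LS S) := fun S => by
    refine LipschitzWith.of_le_add fun v w => ?_
    have hsum : ∑ i, ℓ v (S i) ≤ ∑ i, (ℓ w (S i) + ‖v - w‖) :=
      Finset.sum_le_sum fun i _ => by linarith [hℓ v w (S i)]
    simp only [Finset.sum_add_distrib, Finset.sum_const, Finset.card_univ, Fintype.card_fin,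
      nsmul_eq_mul] at hsum
    have := mul_le_mul_of_nonneg_left hsum (one_div_nonneg.2 hm0.le)
    rw [mul_add, ← mul_assoc (1 / (m : ℝ)) m, one_div_mul_cancel hm0.ne', one_mul] at this
    simpa only [hLS, dist_eq_norm] using this
  have hLSmeas : ∀ v, Measurable fun S => LS S v := fun v => by
    simp only [hLS]
    exact (Finset.measurable_sum _ fun i _ =>
      (hmeas v).comp (measurable_pi_apply i)).const_mul _
  have hvm : Measurable vS :=
    measurable_of_isMin_add_sq hLSconv (fun S => (hLSlip S).continuous) hLSmeas hc hvS
  have hℓm : Measurable (Function.uncurry ℓ) :=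
    (measurable_uncurry_of_continuous_of_measurable
      (u := fun v z => ℓ v z) (fun z => (hlip z).continuous) hmeas)
  have hbound : ∀ S, ‖vS S‖ ≤ 1 / (lam / 2) := fun S =>
    (hLSlip S).norm_le_of_isMin_add_sq hc (hvS S)
  have hnorm : ∀ S z, ‖ℓ (vS S) z‖ ≤ ‖ℓ 0 z‖ + 1 / (lam / 2) := fun S z => by
    have h1 := (norm_le_norm_add_norm_sub' (ℓ (vS S) z) (ℓ 0 z))
    have h2 := (hlip z).dist_le_mul (vS S) 0
    simp only [NNReal.coe_one, one_mul, dist_eq_norm] at h2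
    rw [sub_zero] at h2
    linarith [hbound S]
  have hint_prod : Integrable (fun p : (Fin m → Z) × Z => ℓ (vS p.1) p.2) (P.prod D) := by
    refine Integrable.mono' (((hint 0).norm.comp_snd P).add (integrable_const (1 / (lam / 2))))
      (hℓm.comp ((hvm.comp measurable_fst).prodMk measurable_snd)).aestronglyMeasurable
      (Filter.Eventually.of_forall fun p => hnorm p.1 p.2)
  have hint_diag : ∀ i, Integrable (fun S : Fin m → Z => ℓ (vS S) (S i)) P := fun i => by
    have h0 : Integrable (fun S : Fin m → Z => ‖ℓ 0 (S i)‖) P :=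
      (measurePreserving_eval (fun _ : Fin m => D) i).integrable_comp_of_integrable (hint 0).norm
    refine Integrable.mono' (h0.add (integrable_const (1 / (lam / 2))))
      (hℓm.comp (hvm.prodMk (measurable_pi_apply i))).aestronglyMeasurable
      (Filter.Eventually.of_forall fun S => hnorm S (S i))
  have hstab : ∀ i S z, ℓ (vS S) z - ℓ (vS (Function.update S i z)) z ≤ 2 / (lam * m) := by
    intro i S z
    set S' := Function.update S i z with hS'
    have hdiff : ∀ v, LS S v - LS S' v = 1 / m * (ℓ v (S i) - ℓ v z) := fun v => by
      simp only [hLS]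
      rw [← mul_sub, ← Finset.sum_sub_distrib, Finset.sum_eq_single i]
      · simp [hS']
      · intro j _ hj
        simp [hS', Function.update_of_ne hj]
      · simp
    have hclose := norm_sub_le_of_isMin_add_sq (hLSconv S) (hLSconv S') hc
      (K := 1 / m) (by positivity) (hvS S) (hvS S') (by
        rw [hdiff, hdiff, ← mul_sub, mul_comm 2, mul_assoc]
        refine mul_le_mul_of_nonneg_left ?_ (by positivity)
        have h1 := hℓ (vS S') (vS S) (S i)
        rw [norm_sub_rev] at h1
        linarith [hℓ (vS S) (vS S') z])
    calc _ ≤ ‖vS S - vS S'‖ := hℓ _ _ _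
      _ ≤ 1 / m / (lam / 2) := hclose
      _ = 2 / (lam * m) := by field_simp
  have hi : ∀ i, ∫ S, LD (vS S) ∂P - ∫ S, ℓ (vS S) (S i) ∂P ≤ 2 / (lam * m) := fun i => by
    have hmp := measurePreserving_update_prod D i
    have hint_upd : Integrable (fun p : (Fin m → Z) × Z =>
        ℓ (vS (Function.update p.1 i p.2)) p.2) (P.prod D) := by
      simpa [Function.comp_def] using hmp.integrable_comp_of_integrable (hint_diag i)
    have h1 : ∫ S, LD (vS S) ∂P = ∫ p, ℓ (vS p.1) p.2 ∂(P.prod D) := by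
      rw [integral_prod _ hint_prod, hLD]
    have h2 : ∫ S, ℓ (vS S) (S i) ∂P
        = ∫ p, ℓ (vS (Function.update p.1 i p.2)) p.2 ∂(P.prod D) := by
      have hmap := integral_map (μ := P.prod D) hmp.measurable.aemeasurable
        (f := fun S : Fin m → Z => ℓ (vS S) (S i))
        (by rw [hmp.map_eq]; exact (hint_diag i).aestronglyMeasurable)
      rw [hmp.map_eq] at hmap
      simpa using hmap
    rw [h1, h2, ← integral_sub hint_prod hint_upd]
    refine (integral_mono (hint_prod.sub hint_upd) (integrable_const (2 / (lam * m)))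
      fun p => hstab i p.1 p.2).trans ?_
    simp
  have hintLD : Integrable (fun S => LD (vS S)) P := by
    simpa only [hLD] using hint_prod.integral_prod_left
  have hintLS : Integrable (fun S => LS S (vS S)) P := by
    simp only [hLS]
    exact (integrable_finsetSum _ fun i _ => hint_diag i).const_mul _
  have hLSint : ∫ S, LS S (vS S) ∂P = 1 / m * ∑ i, ∫ S, ℓ (vS S) (S i) ∂P := by
    simp only [hLS]
    rw [integral_const_mul, integral_finsetSum _ fun i _ => hint_diag i]
  rw [integral_sub hintLD hintLS, hLSint]
  have hsum := Finset.sum_le_sum fun (i : Fin m) (_ : i ∈ Finset.univ) => hi i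
  simp only [Finset.sum_sub_distrib, Finset.sum_const, Finset.card_univ, Fintype.card_fin,
    nsmul_eq_mul] at hsum
  refine le_of_mul_le_mul_left ?_ hm0
  rwa [mul_sub, ← mul_assoc (m : ℝ) (1 / m), mul_one_div_cancel hm0.ne', one_mul]
end
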